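/- Fix n ≥ 2 and work in the exterior-form model Σ := ⋀•(ℂ^{2n−1}) with ω := Σ_{p=1}^{n−1} y_{2p}∧y_{2p+1}. Let K := span_ℂ{ ψ_k : −1 ≤ k ≤ n−1 } where ψ_k := ω^{k+1} − i(k+1)·y₁∧ω^k, and define Ψ₀ := Σ_{k=0}^{⌊(n−1)/2⌋} (1/(2k+1)!)·ψ_{2k} and Ψ₁ := Σ_{k=0}^{⌊n/2⌋} (1/(2k)!)·ψ_{2k−1}. Then: (1) c₃(Ψ₀) = i·Ψ₁; and (2) the set { Ψ ∈ K : c₃(Ψ) ∈ K } is a 2-dimensional complex subspace of K equal to span_ℂ{ Ψ₀, Ψ₁ }. (In the 3-Sasakian setting this subspace is the invariant part of the bundle E₃⁻ = 𝓔₃ associated to the third Sasakian structure.) -/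

import Mathlib

noncomputable section

/-- The underlying `(2n-1)`-dimensional complex vector space `ℂ^{2n-1}`. -/
abbrev ModelV (n : ℕ) : Type := Fin (2 * n - 1) → ℂ

/-- The exterior-form model `Σ = ⋀•(ℂ^{2n-1})` of the spinor module. -/
abbrev SpinorModel (n : ℕ) : Type := ExteriorAlgebra ℂ (ModelV n)

/-- The generator `y_{j+1}` (so `j` is the 0-based index), with junk value `0` out of range. -/
def yGen (n j : ℕ) : SpinorModel n :=
  if h : j < 2 * n - 1 then
    ExteriorAlgebra.ι ℂ (Pi.single (⟨j, h⟩ : Fin (2 * n - 1)) (1 : ℂ))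
  else 0

/-- Left exterior multiplication `y_{j+1} ∧ ·` (0-based index `j`). -/
def wdg (n j : ℕ) : SpinorModel n →ₗ[ℂ] SpinorModel n :=
  LinearMap.mulLeft ℂ (yGen n j)

/-- Contraction `x_{j+1} ⌟ ·` with the `(j+1)`-st dual basis vector (0-based index `j`),
with junk value `0` out of range. -/
def ctr (n j : ℕ) : SpinorModel n →ₗ[ℂ] SpinorModel n :=
  if h : j < 2 * n - 1 then
    CliffordAlgebra.contractLeft (LinearMap.proj (⟨j, h⟩ : Fin (2 * n - 1)))
  else 0

/-- The Clifford multiplication operators `c_a`, `1 ≤ a ≤ 4n-1`, of the exterior-form model: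
`c₁ = i·Id` on even degrees and `-i·Id` on odd degrees, `c_{2j} = i(x_j⌟ + y_j∧)` and
`c_{2j+1} = y_j∧ - x_j⌟` for `1 ≤ j ≤ 2n-1` (1-based indices). -/
def cop (n a : ℕ) : SpinorModel n →ₗ[ℂ] SpinorModel n :=
  if a = 1 then
    Complex.I • (CliffordAlgebra.involute : SpinorModel n →ₐ[ℂ] SpinorModel n).toLinearMap
  else if a % 2 = 0 then Complex.I • (ctr n (a / 2 - 1) + wdg n (a / 2 - 1))
  else wdg n (a / 2 - 1) - ctr n (a / 2 - 1)

/-- The invariant `2`-form `ω = ∑_{p=1}^{n-1} y_{2p} ∧ y_{2p+1}`. -/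
def om (n : ℕ) : SpinorModel n :=
  ∑ p ∈ Finset.Icc 1 (n - 1), yGen n (2 * p - 1) * yGen n (2 * p)

/-- The invariant Killing spinors `ψ_k = ω^{k+1} - i(k+1)·y₁∧ω^k`, reindexed by
`j = k + 1` (so `psi n j` is `ψ_{j-1}`, and `psi n 0 = ψ_{-1} = 1`). -/
def psi (n j : ℕ) : SpinorModel n :=
  om n ^ j - (Complex.I * (j : ℂ)) • (yGen n 0 * om n ^ (j - 1))

/-- The space of invariant spinors `Σ_inv = span_ℂ{ω^k, y₁∧ω^k : 0 ≤ k ≤ n-1}`. -/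
def Sinv (n : ℕ) : Submodule ℂ (SpinorModel n) :=
  Submodule.span ℂ {x | ∃ k ≤ n - 1, x = om n ^ k ∨ x = yGen n 0 * om n ^ k}

/-- The space of invariant Killing spinors `K = span_ℂ{ψ_k : -1 ≤ k ≤ n-1}`. -/
def KSpan (n : ℕ) : Submodule ℂ (SpinorModel n) :=
  Submodule.span ℂ {x | ∃ j ≤ n, x = psi n j}


/-- `Ψ_{𝓔₃,0} = ∑_{k=0}^{⌊(n-1)/2⌋} (1/(2k+1)!)·ψ_{2k}` (recall `psi n j = ψ_{j-1}`). -/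
def PsiE3₀ (n : ℕ) : SpinorModel n :=
  ∑ k ∈ Finset.range ((n - 1) / 2 + 1),
    ((1 : ℂ) / ((2 * k + 1).factorial : ℂ)) • psi n (2 * k + 1)

/-- `Ψ_{𝓔₃,1} = ∑_{k=0}^{⌊n/2⌋} (1/(2k)!)·ψ_{2k-1}` (recall `psi n j = ψ_{j-1}`). -/
def PsiE3₁ (n : ℕ) : SpinorModel n :=
  ∑ k ∈ Finset.range (n / 2 + 1),
    ((1 : ℂ) / ((2 * k).factorial : ℂ)) • psi n (2 * k)

section Generic

variable {A : Type*} [Ring A]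

theorem Commute.add_pow_succ_of_mul_self_eq_zero {a b : A} (h : Commute a b) (hb : b * b = 0)
    (k : ℕ) : (a + b) ^ (k + 1) = a ^ (k + 1) + (k + 1) • (b * a ^ k) := by
  induction k with
  | zero => simp
  | succ k ih =>
    have h₁ : a * (b * a ^ k) = b * a ^ (k + 1) := by
      rw [← mul_assoc, h.eq, mul_assoc, pow_succ']
    have h₂ : b * (b * a ^ k) = 0 := by rw [← mul_assoc, hb, zero_mul]
    rw [pow_succ', ih, add_mul, mul_add, mul_add, mul_smul_comm, mul_smul_comm, h₁, h₂,
      ← pow_succ', succ_nsmul _ (k + 1)]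
    simp only [smul_zero, add_zero]
    abel

theorem eq_zero_of_sum_smul_pow_eq_zero {F : Type*} [Field F] [Algebra F A] {w : A} {n : ℕ}
    (hw : w ^ n = 0) (hw' : w ^ (n - 1) ≠ 0) {c : ℕ → F}
    (h : ∑ k ∈ Finset.range n, c k • w ^ k = 0) : ∀ k < n, c k = 0 := by
  intro m
  induction m using Nat.strong_induction_on with
  | _ m ih =>
    intro hm
    have h₁ : ∑ k ∈ Finset.range n, c k • w ^ (k + (n - 1 - m)) = 0 := by
      simpa [Finset.sum_mul, pow_add] using congrArg (· * w ^ (n - 1 - m)) h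
    rw [Finset.sum_eq_single m] at h₁
    · rw [show m + (n - 1 - m) = n - 1 by omega] at h₁
      exact (smul_eq_zero.mp h₁).resolve_right hw'
    · intro k hk hkm
      rcases lt_or_gt_of_ne hkm with hlt | hgt
      · rw [ih k hlt (by omega), zero_smul]
      · rw [pow_eq_zero_of_le (by omega) hw, smul_zero]
    · intro hm'
      exact absurd (Finset.mem_range.mpr hm) hm'

end Generic

theorem Finset.sum_range_ite_odd {M : Type*} [AddCommMonoid M] (f : ℕ → M) (N : ℕ) :
    ∑ j ∈ Finset.range N, (if Odd j then f j else 0) =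
      ∑ k ∈ Finset.range (N / 2), f (2 * k + 1) := by
  induction N with
  | zero => simp
  | succ N ih =>
    rw [Finset.sum_range_succ, ih]
    rcases Nat.even_or_odd' N with ⟨m, rfl | rfl⟩
    · rw [if_neg (by simp), show (2 * m + 1) / 2 = 2 * m / 2 by omega, add_zero]
    · rw [if_pos (by simp), show (2 * m + 1 + 1) / 2 = m + 1 by omega,
        show (2 * m + 1) / 2 = m by omega, Finset.sum_range_succ]

theorem Finset.sum_range_ite_even {M : Type*} [AddCommMonoid M] (f : ℕ → M) (N : ℕ) :
    ∑ j ∈ Finset.range N, (if Even j then f j else 0) =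
      ∑ k ∈ Finset.range ((N + 1) / 2), f (2 * k) := by
  induction N with
  | zero => simp
  | succ N ih =>
    rw [Finset.sum_range_succ, ih]
    rcases Nat.even_or_odd' N with ⟨m, rfl | rfl⟩
    · rw [if_pos (by simp), show (2 * m + 1 + 1) / 2 = m + 1 by omega,
        show (2 * m + 1) / 2 = m by omega, Finset.sum_range_succ]
    · rw [if_neg (by simp), show (2 * m + 1 + 1 + 1) / 2 = (2 * m + 1 + 1) / 2 by omega, add_zero]

section Generators

variable {n : ℕ}

theorem yGen_mul_self (i : ℕ) : yGen n i * yGen n i = 0 := by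
  unfold yGen
  split
  · exact ExteriorAlgebra.ι_sq_zero _
  · simp

theorem yGen_mul_swap (i j : ℕ) : yGen n i * yGen n j = -(yGen n j * yGen n i) := by
  unfold yGen
  split_ifs
  · exact eq_neg_of_add_eq_zero_left (ExteriorAlgebra.ι_add_mul_swap _ _)
  all_goals simp

theorem commute_yGen_mul (a b c : ℕ) : Commute (yGen n c) (yGen n a * yGen n b) := by
  rw [commute_iff_eq, ← mul_assoc, yGen_mul_swap c a, neg_mul, mul_assoc, yGen_mul_swap c b,
    mul_neg, neg_neg, mul_assoc]

theorem yGen_mul_mul_self (a b : ℕ) :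
    (yGen n a * yGen n b) * (yGen n a * yGen n b) = 0 := by
  rw [mul_assoc, (commute_yGen_mul a b b).eq, mul_assoc, yGen_mul_self, mul_zero, mul_zero]

theorem ctr_yGen_mul_self {i : ℕ} (hi : i < 2 * n - 1) (x : SpinorModel n) :
    ctr n i (yGen n i * x) = x - yGen n i * ctr n i x := by
  simp only [ctr, yGen, dif_pos hi]
  refine (CliffordAlgebra.contractLeft_ι_mul _ _ _).trans ?_
  simp [ExteriorAlgebra.ι]

theorem ctr_yGen_mul_of_ne {i j : ℕ} (hij : i ≠ j) (x : SpinorModel n) :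
    ctr n i (yGen n j * x) = -(yGen n j * ctr n i x) := by
  by_cases hi : i < 2 * n - 1
  · by_cases hj : j < 2 * n - 1
    · simp only [ctr, yGen, dif_pos hi, dif_pos hj]
      refine (CliffordAlgebra.contractLeft_ι_mul _ _ _).trans ?_
      have hne : (⟨i, hi⟩ : Fin (2 * n - 1)) ≠ ⟨j, hj⟩ := by simpa using hij
      simp [ExteriorAlgebra.ι, Pi.single_eq_of_ne hne]
    · simp [yGen, dif_neg hj]
  · simp [ctr, dif_neg hi]

theorem ctr_one (i : ℕ) : ctr n i 1 = 0 := by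
  unfold ctr
  split
  · exact CliffordAlgebra.contractLeft_one (Q := (0 : QuadraticForm ℂ (ModelV n))) _
  · rfl

/-- The partial sums `∑_{p=1}^{m} y_{2p} ∧ y_{2p+1}` of `om n`. -/
def omPartial (n m : ℕ) : SpinorModel n :=
  ∑ p ∈ Finset.Icc 1 m, yGen n (2 * p - 1) * yGen n (2 * p)

theorem omPartial_succ (m : ℕ) : omPartial n (m + 1) =
    omPartial n m + yGen n (2 * m + 1) * yGen n (2 * m + 2) := by
  rw [omPartial, Finset.sum_Icc_succ_top (by omega)]
  rfl

theorem commute_yGen_omPartial (i m : ℕ) : Commute (yGen n i) (omPartial n m) :=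
  Commute.sum_right _ _ _ fun _ _ => commute_yGen_mul _ _ _

theorem omPartial_succ_pow_succ (m k : ℕ) : omPartial n (m + 1) ^ (k + 1) =
    omPartial n m ^ (k + 1) +
      (k + 1) • (yGen n (2 * m + 1) * yGen n (2 * m + 2) * omPartial n m ^ k) := by
  rw [omPartial_succ]
  exact ((commute_yGen_omPartial _ m).mul_left
    (commute_yGen_omPartial _ m)).symm.add_pow_succ_of_mul_self_eq_zero (yGen_mul_mul_self _ _) k

theorem ctr_omPartial_mul {i m : ℕ} (h : ∀ p ∈ Finset.Icc 1 m, i ≠ 2 * p - 1 ∧ i ≠ 2 * p)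
    (x : SpinorModel n) : ctr n i (omPartial n m * x) = omPartial n m * ctr n i x := by
  simp only [omPartial, Finset.sum_mul, map_sum]
  refine Finset.sum_congr rfl fun p hp => ?_
  rw [mul_assoc, ctr_yGen_mul_of_ne (h p hp).1, ctr_yGen_mul_of_ne (h p hp).2, mul_neg, neg_neg,
    mul_assoc]

theorem ctr_omPartial_pow {i m : ℕ} (h : ∀ p ∈ Finset.Icc 1 m, i ≠ 2 * p - 1 ∧ i ≠ 2 * p)
    (k : ℕ) : ctr n i (omPartial n m ^ k) = 0 := by
  induction k with
  | zero => rw [pow_zero, ctr_one]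
  | succ k ih => rw [pow_succ', ctr_omPartial_mul h, ih, mul_zero]

theorem omPartial_pow_succ_eq_zero (m : ℕ) : omPartial n m ^ (m + 1) = 0 := by
  induction m with
  | zero => simp [omPartial]
  | succ m ih => rw [omPartial_succ_pow_succ, pow_succ _ (m + 1), ih]; simp

theorem omPartial_pow_ne_zero {m : ℕ} (hm : m ≤ n - 1) : omPartial n m ^ m ≠ 0 := by
  induction m with
  | zero => simp
  | succ m ih =>
    intro h
    rw [omPartial_succ_pow_succ, omPartial_pow_succ_eq_zero, zero_add, ← Nat.cast_smul_eq_nsmul ℂ,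
      smul_eq_zero] at h
    have h₁ := h.resolve_left (Nat.cast_ne_zero.mpr m.succ_ne_zero)
    have hodd : ctr n (2 * m + 1) (omPartial n m ^ m) = 0 :=
      ctr_omPartial_pow (fun p hp => by rw [Finset.mem_Icc] at hp; omega) m
    have heven : ctr n (2 * m + 2) (omPartial n m ^ m) = 0 :=
      ctr_omPartial_pow (fun p hp => by rw [Finset.mem_Icc] at hp; omega) m
    have h₂ := congrArg (fun x => ctr n (2 * m + 2) (ctr n (2 * m + 1) x)) h₁
    simp only [map_zero] at h₂
    rw [mul_assoc, ctr_yGen_mul_self (by omega), ctr_yGen_mul_of_ne (by omega), hodd, mul_zero,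
      neg_zero, mul_zero, sub_zero, ctr_yGen_mul_self (by omega), heven, mul_zero, sub_zero] at h₂
    exact ih (by omega) h₂

end Generators

section Invariant

variable {n : ℕ}

theorem om_pow_eq_zero (hn : 2 ≤ n) : om n ^ n = 0 := by
  have h := omPartial_pow_succ_eq_zero (n := n) (n - 1)
  rwa [Nat.sub_add_cancel (by omega)] at h

theorem om_pow_pred_ne_zero : om n ^ (n - 1) ≠ 0 :=
  omPartial_pow_ne_zero le_rfl

theorem ctr_zero_om_pow (k : ℕ) : ctr n 0 (om n ^ k) = 0 :=
  ctr_omPartial_pow (fun p hp => by rw [Finset.mem_Icc] at hp; omega) k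

theorem ctr_zero_yGen_mul_om_pow (hn : 2 ≤ n) (k : ℕ) :
    ctr n 0 (yGen n 0 * om n ^ k) = om n ^ k := by
  rw [ctr_yGen_mul_self (by omega), ctr_zero_om_pow, mul_zero, sub_zero]

/-- The invariant spinor with coordinates `c`, `d` in the family `ω^k`, `y₁ ∧ ω^k`. -/
def invSpinor (n : ℕ) (c d : ℕ → ℂ) : SpinorModel n :=
  ∑ k ∈ Finset.range n, (c k • om n ^ k + d k • (yGen n 0 * om n ^ k))

theorem invSpinor_congr {c d c' d' : ℕ → ℂ} (hc : ∀ k < n, c k = c' k) (hd : ∀ k < n, d k = d' k) :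
    invSpinor n c d = invSpinor n c' d' :=
  Finset.sum_congr rfl fun k hk => by
    rw [hc k (Finset.mem_range.mp hk), hd k (Finset.mem_range.mp hk)]

theorem smul_invSpinor (a : ℂ) (c d : ℕ → ℂ) :
    a • invSpinor n c d = invSpinor n (fun k => a * c k) (fun k => a * d k) := by
  simp only [invSpinor, Finset.smul_sum, smul_add, smul_smul]

theorem invSpinor_sub (c d c' d' : ℕ → ℂ) :
    invSpinor n c d - invSpinor n c' d' =
      invSpinor n (fun k => c k - c' k) (fun k => d k - d' k) := by
  simp only [invSpinor, ← Finset.sum_sub_distrib]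
  refine Finset.sum_congr rfl fun k _ => ?_
  module

theorem ctr_zero_invSpinor (hn : 2 ≤ n) (c d : ℕ → ℂ) :
    ctr n 0 (invSpinor n c d) = ∑ k ∈ Finset.range n, d k • om n ^ k := by
  simp [invSpinor, ctr_zero_om_pow, ctr_zero_yGen_mul_om_pow hn]

theorem cop_three_invSpinor (hn : 2 ≤ n) (c d : ℕ → ℂ) :
    cop n 3 (invSpinor n c d) = invSpinor n (fun k => -d k) c := by
  have h : cop n 3 = wdg n 0 - ctr n 0 := rfl
  rw [h, LinearMap.sub_apply, ctr_zero_invSpinor hn]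
  simp only [wdg, invSpinor, LinearMap.mulLeft_apply, Finset.mul_sum, mul_add, mul_smul_comm,
    ← mul_assoc, yGen_mul_self, zero_mul, smul_zero, add_zero, ← Finset.sum_sub_distrib]
  refine Finset.sum_congr rfl fun k _ => ?_
  module

theorem invSpinor_eq_zero (hn : 2 ≤ n) {c d : ℕ → ℂ} (h : invSpinor n c d = 0) :
    ∀ k < n, c k = 0 ∧ d k = 0 := by
  have hd : ∀ k < n, d k = 0 := by
    refine eq_zero_of_sum_smul_pow_eq_zero (om_pow_eq_zero hn) om_pow_pred_ne_zero ?_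
    rw [← ctr_zero_invSpinor hn c d, h, map_zero]
  refine fun k hk => ⟨?_, hd k hk⟩
  refine eq_zero_of_sum_smul_pow_eq_zero (om_pow_eq_zero hn) om_pow_pred_ne_zero ?_ k hk
  rw [← h, invSpinor]
  refine Finset.sum_congr rfl fun k hk => ?_
  rw [hd k (Finset.mem_range.mp hk), zero_smul, add_zero]

theorem invSpinor_inj (hn : 2 ≤ n) {c d c' d' : ℕ → ℂ}
    (h : invSpinor n c d = invSpinor n c' d') : ∀ k < n, c k = c' k ∧ d k = d' k := by
  rw [← sub_eq_zero, invSpinor_sub] at h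
  simpa only [sub_eq_zero] using invSpinor_eq_zero hn h

/-- The combination `∑_{j=0}^{n} a_j ψ_{j-1}` of invariant Killing spinors. -/
def killingSpinor (n : ℕ) (a : ℕ → ℂ) : SpinorModel n :=
  ∑ j ∈ Finset.range (n + 1), a j • psi n j

theorem mem_KSpan_iff {x : SpinorModel n} : x ∈ KSpan n ↔ ∃ a, killingSpinor n a = x := by
  have h : KSpan n = Submodule.span ℂ (psi n '' (Finset.range (n + 1) : Finset ℕ)) := by
    unfold KSpan
    congr 1
    ext y
    simp [eq_comm]
  rw [h, Submodule.mem_span_image_finset_iff_exists_fun']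
  rfl

theorem smul_add_smul_killingSpinor (s t : ℂ) (a b : ℕ → ℂ) :
    s • killingSpinor n a + t • killingSpinor n b =
      killingSpinor n (fun j => s * a j + t * b j) := by
  simp only [killingSpinor, Finset.smul_sum, smul_smul, add_smul, Finset.sum_add_distrib]

theorem killingSpinor_eq_invSpinor (hn : 2 ≤ n) (a : ℕ → ℂ) :
    killingSpinor n a = invSpinor n a (fun k => -(Complex.I * (k + 1) * a (k + 1))) := by
  simp only [killingSpinor, psi, smul_sub, invSpinor, Finset.sum_sub_distrib,
    Finset.sum_add_distrib]
  rw [Finset.sum_range_succ, om_pow_eq_zero hn, smul_zero, add_zero, Finset.sum_range_succ',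
    sub_eq_add_neg]
  congr 1
  simp only [Nat.cast_zero, mul_zero, zero_smul, smul_zero, add_zero, ← Finset.sum_neg_distrib]
  refine Finset.sum_congr rfl fun k _ => ?_
  rw [Nat.add_sub_cancel]
  push_cast
  module

theorem cop_three_killingSpinor (hn : 2 ≤ n) (a : ℕ → ℂ) :
    cop n 3 (killingSpinor n a) =
      invSpinor n (fun k => Complex.I * (k + 1) * a (k + 1)) a := by
  rw [killingSpinor_eq_invSpinor hn, cop_three_invSpinor hn]
  simp only [neg_neg]

theorem cop_three_killingSpinor_eq_I_smul (hn : 2 ≤ n) {a b : ℕ → ℂ}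
    (hab : ∀ k : ℕ, (k + 1) * a (k + 1) = b k) (hba : ∀ k : ℕ, (k + 1) * b (k + 1) = a k) :
    cop n 3 (killingSpinor n a) = Complex.I • killingSpinor n b := by
  rw [cop_three_killingSpinor hn, killingSpinor_eq_invSpinor hn, smul_invSpinor]
  refine invSpinor_congr (fun k _ => ?_) (fun k _ => ?_)
  · rw [mul_assoc, hab]
  · rw [← hba]
    linear_combination ((k + 1) * b (k + 1)) * Complex.I_mul_I

/-- The coefficients of `sinh`. -/
def sinhCoeff (j : ℕ) : ℂ := if Odd j then 1 / (j.factorial : ℂ) else 0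

/-- The coefficients of `cosh`. -/
def coshCoeff (j : ℕ) : ℂ := if Even j then 1 / (j.factorial : ℂ) else 0

theorem succ_mul_one_div_factorial_succ (k : ℕ) :
    ((k : ℂ) + 1) * (1 / ((k + 1).factorial : ℂ)) = 1 / (k.factorial : ℂ) := by
  have h₁ : (k : ℂ) + 1 ≠ 0 := by exact_mod_cast k.succ_ne_zero
  have h₂ : (k.factorial : ℂ) ≠ 0 := by exact_mod_cast k.factorial_ne_zero
  rw [Nat.factorial_succ]
  push_cast
  field_simp

theorem succ_mul_sinhCoeff_succ (k : ℕ) : ((k : ℂ) + 1) * sinhCoeff (k + 1) = coshCoeff k := by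
  simp only [sinhCoeff, coshCoeff, Nat.odd_add_one, Nat.not_odd_iff_even, mul_ite, mul_zero,
    succ_mul_one_div_factorial_succ]

theorem succ_mul_coshCoeff_succ (k : ℕ) : ((k : ℂ) + 1) * coshCoeff (k + 1) = sinhCoeff k := by
  simp only [sinhCoeff, coshCoeff, Nat.even_add_one, Nat.not_even_iff_odd, mul_ite, mul_zero,
    succ_mul_one_div_factorial_succ]

theorem PsiE3₀_eq_killingSpinor (hn : 2 ≤ n) : PsiE3₀ n = killingSpinor n sinhCoeff := by
  simp only [killingSpinor, sinhCoeff, ite_smul, zero_smul]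
  rw [Finset.sum_range_ite_odd (fun j => (1 / (j.factorial : ℂ)) • psi n j), PsiE3₀,
    show (n + 1) / 2 = (n - 1) / 2 + 1 by omega]

theorem PsiE3₁_eq_killingSpinor : PsiE3₁ n = killingSpinor n coshCoeff := by
  simp only [killingSpinor, coshCoeff, ite_smul, zero_smul]
  rw [Finset.sum_range_ite_even (fun j => (1 / (j.factorial : ℂ)) • psi n j), PsiE3₁,
    show (n + 1 + 1) / 2 = n / 2 + 1 by omega]

theorem eq_sinhCoeff_add_coshCoeff {a : ℕ → ℂ}
    (h : ∀ k, k + 1 < n → a k = (k + 1) * ((k + 2) * a (k + 2))) :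
    ∀ k ≤ n, a k = a 1 * sinhCoeff k + a 0 * coshCoeff k
  | 0, _ => by simp [sinhCoeff, coshCoeff]
  | 1, _ => by simp [sinhCoeff, coshCoeff]
  | k + 2, hk => by
    have h₁ : ((k + 1 : ℕ) : ℂ) ≠ 0 := Nat.cast_ne_zero.mpr (by omega)
    have h₂ : ((k + 2 : ℕ) : ℂ) ≠ 0 := Nat.cast_ne_zero.mpr (by omega)
    have ih := eq_sinhCoeff_add_coshCoeff h k (by omega)
    have hs := succ_mul_sinhCoeff_succ (k + 1)
    have hs' := succ_mul_coshCoeff_succ k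
    have hc := succ_mul_coshCoeff_succ (k + 1)
    have hc' := succ_mul_sinhCoeff_succ k
    have hk' := h k (by omega)
    apply mul_left_cancel₀ (mul_ne_zero h₁ h₂)
    push_cast at *
    linear_combination ih - hk' - a 1 * hs' - a 0 * hc' - a 1 * (k + 1) * hs - a 0 * (k + 1) * hc

end Invariant

/-- For `n ≥ 2`, within the space `K = span_ℂ{ψ_k : -1 ≤ k ≤ n-1}` of
invariant Killing spinors: (1) `c₃(Ψ₀) = i·Ψ₁`; and (2) the set `{Ψ ∈ K : c₃(Ψ) ∈ K}` is a
2-dimensional complex subspace of `K` equal to `span_ℂ{Ψ₀, Ψ₁}`. -/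
theorem E3_invariant_part (n : ℕ) (hn : 2 ≤ n) :
    cop n 3 (PsiE3₀ n) = Complex.I • PsiE3₁ n ∧
    {Ψ : SpinorModel n | Ψ ∈ KSpan n ∧ cop n 3 Ψ ∈ KSpan n} =
      (Submodule.span ℂ {PsiE3₀ n, PsiE3₁ n} : Submodule ℂ (SpinorModel n)) ∧
    Module.finrank ℂ (Submodule.span ℂ {PsiE3₀ n, PsiE3₁ n}) = 2 := by
  have h₀ : cop n 3 (PsiE3₀ n) = Complex.I • PsiE3₁ n := by
    rw [PsiE3₀_eq_killingSpinor hn, PsiE3₁_eq_killingSpinor]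
    exact cop_three_killingSpinor_eq_I_smul hn succ_mul_sinhCoeff_succ succ_mul_coshCoeff_succ
  have h₁ : cop n 3 (PsiE3₁ n) = Complex.I • PsiE3₀ n := by
    rw [PsiE3₀_eq_killingSpinor hn, PsiE3₁_eq_killingSpinor]
    exact cop_three_killingSpinor_eq_I_smul hn succ_mul_coshCoeff_succ succ_mul_sinhCoeff_succ
  have hK₀ : PsiE3₀ n ∈ KSpan n := mem_KSpan_iff.mpr ⟨_, (PsiE3₀_eq_killingSpinor hn).symm⟩
  have hK₁ : PsiE3₁ n ∈ KSpan n := mem_KSpan_iff.mpr ⟨_, PsiE3₁_eq_killingSpinor.symm⟩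
  refine ⟨h₀, ?_, ?_⟩
  · ext Ψ
    rw [Set.mem_ofPred_eq, SetLike.mem_coe, Submodule.mem_span_pair]
    constructor
    · rintro ⟨hΨ, hcΨ⟩
      obtain ⟨a, rfl⟩ := mem_KSpan_iff.mp hΨ
      obtain ⟨b, hb⟩ := mem_KSpan_iff.mp hcΨ
      rw [killingSpinor_eq_invSpinor hn, cop_three_killingSpinor hn] at hb
      have hab := invSpinor_inj hn hb
      have ha : ∀ k, k + 1 < n → a k = (k + 1) * ((k + 2) * a (k + 2)) := by
        intro k hk
        have e₁ := (hab k (by omega)).2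
        have e₂ := (hab (k + 1) hk).1
        push_cast at e₂
        linear_combination -e₁ - Complex.I * (k + 1) * e₂ -
          (k + 1) * (k + 2) * a (k + 2) * Complex.I_mul_I
      refine ⟨a 1, a 0, ?_⟩
      rw [PsiE3₀_eq_killingSpinor hn, PsiE3₁_eq_killingSpinor, smul_add_smul_killingSpinor]
      refine Finset.sum_congr rfl fun k hk => ?_
      rw [eq_sinhCoeff_add_coshCoeff ha k (Nat.lt_succ_iff.mp (Finset.mem_range.mp hk))]
    · rintro ⟨s, t, rfl⟩
      rw [map_add, map_smul, map_smul, h₀, h₁]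
      exact ⟨add_mem (Submodule.smul_mem _ _ hK₀) (Submodule.smul_mem _ _ hK₁),
        add_mem (Submodule.smul_mem _ _ (Submodule.smul_mem _ _ hK₁))
          (Submodule.smul_mem _ _ (Submodule.smul_mem _ _ hK₀))⟩
  · have hli : LinearIndependent ℂ ![PsiE3₀ n, PsiE3₁ n] := by
      refine LinearIndependent.pair_iff.mpr fun s t h => ?_
      rw [PsiE3₀_eq_killingSpinor hn, PsiE3₁_eq_killingSpinor, smul_add_smul_killingSpinor,
        killingSpinor_eq_invSpinor hn] at h
      have e₀ := (invSpinor_eq_zero hn h 0 (by omega)).1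
      have e₁ := (invSpinor_eq_zero hn h 1 (by omega)).1
      simp [sinhCoeff, coshCoeff] at e₀ e₁
      exact ⟨e₁, e₀⟩
    rw [← Matrix.range_cons_cons_empty _ _ ![], finrank_span_eq_card hli, Fintype.card_fin]
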